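/- Let B(K) act on H = HS(K) by left multiplications with separating and cyclic vector x0. For a normal positive functional ρ on B(H), the following are equivalent: (i) ρ has Schmidt number not bigger than k, i.e. ρ ∈ S_k; (ii) ⟨C_φ, ρ⟩ ≥ 0 for every k-positive map φ ∈ P^σ_k. -/

import Mathlib

set_option synthInstance.maxHeartbeats 1000000
set_option maxHeartbeats 1000000

noncomputable section

open scoped InnerProductSpace ComplexOrder
open ContinuousLinearMap

local notation "⟪" x ", " y "⟫" => @inner ℂ _ _ x y

namespace ChoiInf

variable {H : Type*} [NormedAddCommGroup H] [InnerProductSpace ℂ H] [CompleteSpace H]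

/-- The rank one operator `x ⊠ y : z ↦ (z|y)·x = ⟪y, z⟫ • x`
(inner products written with Mathlib's convention: conjugate linear in the
first variable, so that the paper's `(z|y)` is `⟪y, z⟫`). -/
def rankOne (x y : H) : H →L[ℂ] H := (innerSL ℂ y).smulRight x

/-- The trace of an operator, computed relative to a Hilbert basis:
`Tr X = Σᵢ (X eᵢ | eᵢ) = Σᵢ ⟪eᵢ, X eᵢ⟫`.  (For trace class operators this does
not depend on the choice of basis.) -/
def tr {ι : Type*} (b : HilbertBasis ι ℂ H) (T : H →L[ℂ] H) : ℂ :=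
  ∑' i, ⟪b i, T (b i)⟫

/-- The bilinear pairing `⟨A, B⟩ = Tr (A B)` between `B(H)` and `T(H)`. -/
def pairing {ι : Type*} (b : HilbertBasis ι ℂ H) (A T : H →L[ℂ] H) : ℂ :=
  tr b (A ∘L T)

/-- Trace class operators, characterized by nuclear representations
`T = Σₙ xₙ ⊠ yₙ` with `Σₙ ‖xₙ‖‖yₙ‖ < ∞`. -/
def IsTraceClass (T : H →L[ℂ] H) : Prop :=
  ∃ x y : ℕ → H, Summable (fun n => ‖x n‖ * ‖y n‖) ∧
    ∀ z, T z = ∑' n, ⟪y n, z⟫ • x n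

/-- The trace norm, as the infimum of `Σₙ ‖xₙ‖‖yₙ‖` over all nuclear
representations `T = Σₙ xₙ ⊠ yₙ`. -/
def traceNorm (T : H →L[ℂ] H) : ℝ :=
  sInf {c : ℝ | ∃ x y : ℕ → H, HasSum (fun n => ‖x n‖ * ‖y n‖) c ∧
    ∀ z, T z = ∑' n, ⟪y n, z⟫ • x n}

/-- `(Φ, Φst)` is a dual pair:  `Φst` preserves the trace class and
`⟨Φ A, T⟩ = ⟨A, Φst T⟩` for all trace class `T`.  A linear map `Φ` on `B(H)` is
normal (σ-weakly continuous) precisely when it admits such a predual map `Φst`. -/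
def IsNormalPair {ι : Type*} (b : HilbertBasis ι ℂ H)
    (Φ Φst : (H →L[ℂ] H) →ₗ[ℂ] (H →L[ℂ] H)) : Prop :=
  (∀ T, IsTraceClass T → IsTraceClass (Φst T)) ∧
    ∀ A T, IsTraceClass T → pairing b (Φ A) T = pairing b A (Φst T)

/-- Positivity of a `k × k` matrix of operators, i.e. positivity of the
corresponding operator on `H ⊕ ⋯ ⊕ H`. -/
def MatPos {k : ℕ} (A : Fin k → Fin k → (H →L[ℂ] H)) : Prop :=
  ∀ v : Fin k → H, 0 ≤ ∑ i, ∑ j, ⟪v i, A i j (v j)⟫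

/-- The operator on `H ⊕ ⋯ ⊕ H` given by a `k × k` matrix of operators has norm `≤ c`. -/
def matNormLe {k : ℕ} (A : Fin k → Fin k → (H →L[ℂ] H)) (c : ℝ) : Prop :=
  ∀ v w : Fin k → H,
    ‖∑ i, ∑ j, ⟪w i, A i j (v j)⟫‖ ≤
      c * Real.sqrt (∑ i, ‖v i‖ ^ 2) * Real.sqrt (∑ i, ‖w i‖ ^ 2)

/-- A von Neumann algebra is a factor when its center consists of the scalars. -/
def IsFactor (M : VonNeumannAlgebra H) : Prop :=
  ∀ T ∈ M, T ∈ M.commutant → ∃ c : ℂ, T = c • (1 : H →L[ℂ] H)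

/-- `x0` is a cyclic vector for `M`. -/
def Cyclic (M : VonNeumannAlgebra H) (x0 : H) : Prop :=
  Dense {y : H | ∃ A ∈ M, A x0 = y}

/-- `x0` is a separating vector for `M`. -/
def Separating (M : VonNeumannAlgebra H) (x0 : H) : Prop :=
  ∀ A ∈ M, A x0 = 0 → A = 0

/-- `Φ` restricts on `alg(M', M)` to the map `φ̃ : A'B ↦ A'·φ(B)`.
(Maps `φ : M → M` are encoded as linear maps on `B(H)` sending `M` into `M`;
only the restriction to `M` is relevant.) -/
def ExtendsTilde (M : VonNeumannAlgebra H)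
    (φ Φ : (H →L[ℂ] H) →ₗ[ℂ] (H →L[ℂ] H)) : Prop :=
  ∀ A' ∈ M.commutant, ∀ B ∈ M, Φ (A' * B) = A' * φ B

/-- The space `CB^σ_ε(M)` of maps `φ : M → M` such that `φ̃` extends to a normal
map on `B(H)`. -/
def CBSigmaE {ι : Type*} (b : HilbertBasis ι ℂ H) (M : VonNeumannAlgebra H) :
    Set ((H →L[ℂ] H) →ₗ[ℂ] (H →L[ℂ] H)) :=
  {φ | (∀ B ∈ M, φ B ∈ M) ∧
    ∃ Φ Φst, ExtendsTilde M φ Φ ∧ IsNormalPair b Φ Φst}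

/-- `φ` is completely positive as a map on `M`. -/
def IsCPOn (M : VonNeumannAlgebra H) (φ : (H →L[ℂ] H) →ₗ[ℂ] (H →L[ℂ] H)) : Prop :=
  ∀ (k : ℕ) (A : Fin k → Fin k → (H →L[ℂ] H)), (∀ i j, A i j ∈ M) →
    MatPos A → MatPos fun i j => φ (A i j)

/-- `φ` is completely positive (on all of `B(H)`). -/
def IsCPFull (φ : (H →L[ℂ] H) →ₗ[ℂ] (H →L[ℂ] H)) : Prop :=
  ∀ (k : ℕ) (A : Fin k → Fin k → (H →L[ℂ] H)), MatPos A → MatPos fun i j => φ (A i j)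

/-- `c` is a completely bounded bound for `φ` as a map on `M`. -/
def CBBoundOn (M : VonNeumannAlgebra H) (φ : (H →L[ℂ] H) →ₗ[ℂ] (H →L[ℂ] H))
    (c : ℝ) : Prop :=
  ∀ (k : ℕ) (A : Fin k → Fin k → (H →L[ℂ] H)), (∀ i j, A i j ∈ M) →
    matNormLe A 1 → matNormLe (fun i j => φ (A i j)) c

/-- The completely bounded norm of `φ` as a map on `M`. -/
def cbNormOn (M : VonNeumannAlgebra H) (φ : (H →L[ℂ] H) →ₗ[ℂ] (H →L[ℂ] H)) : ℝ :=
  sInf {c : ℝ | 0 ≤ c ∧ CBBoundOn M φ c}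

/-- `φ` is completely bounded as a map on `M`. -/
def IsCBOn (M : VonNeumannAlgebra H) (φ : (H →L[ℂ] H) →ₗ[ℂ] (H →L[ℂ] H)) : Prop :=
  ∃ c, 0 ≤ c ∧ CBBoundOn M φ c

/-- `φ` is normal as a map on `M`: every normal functional composed with `φ`
is again normal (i.e. implemented by a trace class operator). -/
def NormalOn {ι : Type*} (b : HilbertBasis ι ℂ H) (M : VonNeumannAlgebra H)
    (φ : (H →L[ℂ] H) →ₗ[ℂ] (H →L[ℂ] H)) : Prop :=
  ∀ T, IsTraceClass T → ∃ T', IsTraceClass T' ∧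
    ∀ A ∈ M, pairing b (φ A) T = pairing b A T'

/-- The map `Ad_V : X ↦ V* X V`. -/
def AdL (V : H →L[ℂ] H) : (H →L[ℂ] H) →ₗ[ℂ] (H →L[ℂ] H) where
  toFun X := star V * X * V
  map_add' X Y := by simp [add_mul, mul_add]
  map_smul' c X := by simp [smul_mul_assoc, mul_smul_comm]

/-- `p` is a minimal (nonzero) projection in `M`. -/
def IsMinimalProjection (M : VonNeumannAlgebra H) (p : H →L[ℂ] H) : Prop :=
  p ∈ M ∧ IsIdempotentElem p ∧ IsSelfAdjoint p ∧ p ≠ 0 ∧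
    ∀ q, q ∈ M → IsIdempotentElem q → IsSelfAdjoint q → q ≠ 0 →
      q * p = q → p * q = q → q = p

/-- A factor is of type I precisely when it contains a minimal projection. -/
def IsTypeI (M : VonNeumannAlgebra H) : Prop :=
  ∃ p, IsMinimalProjection M p




variable {K : Type*} [NormedAddCommGroup K] [InnerProductSpace ℂ K] [CompleteSpace K]

/-- `T` is a Hilbert–Schmidt operator (relative to a Hilbert basis `e`;
this does not depend on the choice of `e`). -/
def IsHS {ι : Type*} (e : HilbertBasis ι ℂ K) (T : K →L[ℂ] K) : Prop :=
  Summable fun i => ‖T (e i)‖ ^ 2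

/-- A model of the Hilbert space `HS(K)` of Hilbert–Schmidt operators on `K`,
with `B(K)` acting by left multiplications `Lmul` and right multiplications
`Rmul`.  `toOp` regards a vector of `H` as an operator on `K`; its range is
exactly the set of Hilbert–Schmidt operators, and the inner product of `H` is
`(x|y) = Tr (x y*)`, i.e. `⟪x, y⟫ = Σᵢ ⟪x eᵢ, y eᵢ⟫`. -/
structure HSModel {ι : Type*} (e : HilbertBasis ι ℂ K) (H : Type*)
    [NormedAddCommGroup H] [InnerProductSpace ℂ H] [CompleteSpace H] where
  toOp : H →ₗ[ℂ] (K →L[ℂ] K)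
  inj : Function.Injective toOp
  mem_range : ∀ T : K →L[ℂ] K, IsHS e T ↔ ∃ x : H, toOp x = T
  inner_eq : ∀ x y : H, ⟪x, y⟫ = ∑' i, ⟪toOp x (e i), toOp y (e i)⟫
  Lmul : (K →L[ℂ] K) → (H →L[ℂ] H)
  Lmul_eq : ∀ a x, toOp (Lmul a x) = a ∘L toOp x
  Rmul : (K →L[ℂ] K) → (H →L[ℂ] H)
  Rmul_eq : ∀ a x, toOp (Rmul a x) = toOp x ∘L a

/-- The operator `T` has rank at most `k`. -/
def rankLE (T : K →L[ℂ] K) (k : ℕ) : Prop :=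
  Module.rank ℂ (LinearMap.range (T : K →ₗ[ℂ] K)) ≤ (k : Cardinal)

variable {H : Type*} [NormedAddCommGroup H] [InnerProductSpace ℂ H] [CompleteSpace H]
  {ι : Type*} {e : HilbertBasis ι ℂ K}

/-- `Φ` restricts to the map `φ̃ : R_y L_x ↦ R_y L_{φ(x)}` on `alg(M', M)` for
`M = L_{B(K)}`. -/
def HSExt (m : HSModel e H) (φ : (K →L[ℂ] K) →ₗ[ℂ] (K →L[ℂ] K))
    (Φ : (H →L[ℂ] H) →ₗ[ℂ] (H →L[ℂ] H)) : Prop :=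
  ∀ a x : K →L[ℂ] K, Φ (m.Rmul a ∘L m.Lmul x) = m.Rmul a ∘L m.Lmul (φ x)

/-- `φ` is `k`-positive. -/
def kPos (k : ℕ) (φ : (K →L[ℂ] K) →ₗ[ℂ] (K →L[ℂ] K)) : Prop :=
  ∀ A : Fin k → Fin k → (K →L[ℂ] K), MatPos A → MatPos fun i j => φ (A i j)

/-- `φ` is completely bounded (as a map on all of `B(K)`). -/
def IsCBFullK (φ : (K →L[ℂ] K) →ₗ[ℂ] (K →L[ℂ] K)) : Prop :=
  ∃ c, 0 ≤ c ∧ ∀ (k : ℕ) (A : Fin k → Fin k → (K →L[ℂ] K)),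
    matNormLe A 1 → matNormLe (fun i j => φ (A i j)) c

/-- `φ` belongs to `CB^σ(B(K))`: it is normal and completely bounded. -/
def NormalCB (e : HilbertBasis ι ℂ K) (φ : (K →L[ℂ] K) →ₗ[ℂ] (K →L[ℂ] K)) : Prop :=
  (∃ φst, IsNormalPair e φ φst) ∧ IsCBFullK φ

/-- The cone `𝒮_k` of `T(H)`: the trace-norm closed convex cone generated by
the `ω_{x,x} = x ⊠ x` with `rank x ≤ k` (rank as an operator on `K`). -/
def SchmidtCone (m : HSModel e H) (k : ℕ) : Set (H →L[ℂ] H) :=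
  {T | ∀ ε : ℝ, 0 < ε → ∃ (n : ℕ) (x : Fin n → H),
    (∀ i, rankLE (m.toOp (x i)) k) ∧
      traceNorm (T - ∑ i, rankOne (x i) (x i)) < ε}

/-- `ψ` belongs to the convex cone `𝔼_k` generated by the maps `Ad_V` with
`rank V ≤ k`. -/
def InEk (k : ℕ) (ψ : (K →L[ℂ] K) →ₗ[ℂ] (K →L[ℂ] K)) : Prop :=
  ∃ (n : ℕ) (V : Fin n → (K →L[ℂ] K)), (∀ i, rankLE (V i) k) ∧
    ∀ x, ψ x = ∑ i, star (V i) * x * V i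

/-- `φ` (with Choi trace-class operator `Dphi = D_φ`) is `k`-superpositive:
it lies in the `‖·‖_D`-closure of the cone `𝔼_k`, where `‖ψ‖_D = ‖D_ψ‖_{T(H)}`. -/
def kSuper {ιH : Type*} (bH : HilbertBasis ιH ℂ H) (m : HSModel e H) (x0 : H)
    (k : ℕ) (Dphi : H →L[ℂ] H) : Prop :=
  ∀ ε : ℝ, 0 < ε → ∃ ψ Ψ Ψst, InEk k ψ ∧ HSExt m ψ Ψ ∧ IsNormalPair bH Ψ Ψst ∧
    traceNorm (Dphi - Ψst (rankOne x0 x0)) < ε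


section TraceClass

set_option linter.unusedSectionVars false

lemma rankOne_apply (x y z : H) : rankOne x y z = ⟪y, z⟫ • x := rfl

lemma inner_rankOne (x y z w : H) : ⟪w, rankOne x y z⟫ = ⟪w, x⟫ * ⟪y, z⟫ := by
  rw [rankOne_apply, inner_smul_right, mul_comm]

/-- `T` has a nuclear representation of weight at most `c`. -/
def NucBound (T : H →L[ℂ] H) (c : ℝ) : Prop :=
  ∃ x y : ℕ → H, Summable (fun n => ‖x n‖ * ‖y n‖) ∧ ∑' n, ‖x n‖ * ‖y n‖ ≤ c ∧
    ∀ z, T z = ∑' n, ⟪y n, z⟫ • x n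

lemma isTraceClass_iff_nucBound {T : H →L[ℂ] H} : IsTraceClass T ↔ ∃ c, NucBound T c :=
  ⟨fun ⟨x, y, h, hT⟩ => ⟨_, x, y, h, le_rfl, hT⟩, fun ⟨_, x, y, h, _, hT⟩ => ⟨x, y, h, hT⟩⟩

lemma NucBound.isTraceClass {T : H →L[ℂ] H} {c : ℝ} (h : NucBound T c) : IsTraceClass T :=
  isTraceClass_iff_nucBound.2 ⟨c, h⟩

lemma NucBound.mono {T : H →L[ℂ] H} {c d : ℝ} (h : NucBound T c) (hcd : c ≤ d) :
    NucBound T d := by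
  obtain ⟨x, y, h1, h2, h3⟩ := h
  exact ⟨x, y, h1, h2.trans hcd, h3⟩

lemma NucBound.traceNorm_le {T : H →L[ℂ] H} {c : ℝ} (h : NucBound T c) : traceNorm T ≤ c := by
  obtain ⟨x, y, h1, h2, h3⟩ := h
  unfold traceNorm
  refine le_trans (csInf_le ?_ ⟨x, y, h1.hasSum, h3⟩) h2
  refine ⟨0, ?_⟩
  rintro d ⟨x, y, h, -⟩
  exact h.nonneg fun n => by positivity

lemma IsTraceClass.nucBound {T : H →L[ℂ] H} (hT : IsTraceClass T) {c : ℝ}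
    (h : traceNorm T < c) : NucBound T c := by
  obtain ⟨x, y, h1, h2⟩ := hT
  obtain ⟨d, ⟨x', y', h3, h4⟩, hd⟩ := exists_lt_of_csInf_lt
    (s := {c : ℝ | ∃ x y : ℕ → H, HasSum (fun n => ‖x n‖ * ‖y n‖) c ∧
      ∀ z, T z = ∑' n, ⟪y n, z⟫ • x n}) ⟨_, x, y, h1.hasSum, h2⟩ h
  exact ⟨x', y', h3.summable, h3.tsum_eq.trans_le hd.le, h4⟩

lemma hasSum_nuclear {x y : ℕ → H} (h : Summable fun n => ‖x n‖ * ‖y n‖) (z : H) :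
    HasSum (fun n => ⟪y n, z⟫ • x n) (∑' n, ⟪y n, z⟫ • x n) := by
  refine (Summable.of_norm_bounded (h.mul_left ‖z‖) fun n => ?_).hasSum
  rw [norm_smul]
  calc ‖⟪y n, z⟫‖ * ‖x n‖ ≤ (‖y n‖ * ‖z‖) * ‖x n‖ := by gcongr; exact norm_inner_le_norm _ _
    _ = _ := by ring

lemma nucBound_rankOne (x y : H) : NucBound (rankOne x y) (‖x‖ * ‖y‖) := by
  have h : HasSum (fun n : ℕ => ‖(Pi.single 0 x : ℕ → H) n‖ * ‖(Pi.single 0 y : ℕ → H) n‖)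
      (‖x‖ * ‖y‖) := by
    simpa using hasSum_single (f := fun n : ℕ => ‖(Pi.single 0 x : ℕ → H) n‖ *
      ‖(Pi.single 0 y : ℕ → H) n‖) 0 fun n hn => by simp [hn]
  refine ⟨Pi.single 0 x, Pi.single 0 y, h.summable, h.tsum_eq.le, fun z => ?_⟩
  rw [tsum_eq_single 0 fun n hn => by simp [hn]]
  simp [rankOne_apply]

lemma NucBound.mul_mul {T : H →L[ℂ] H} {x y : ℕ → H} (h : Summable fun n => ‖x n‖ * ‖y n‖)
    (hT : ∀ z, T z = ∑' n, ⟪y n, z⟫ • x n) (A B : H →L[ℂ] H) :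
    (Summable fun n => ‖A (x n)‖ * ‖star B (y n)‖) ∧
      ∀ z, (A * T * B) z = ∑' n, ⟪star B (y n), z⟫ • A (x n) := by
  constructor
  · refine Summable.of_nonneg_of_le (fun n => by positivity) (fun n => ?_)
      (h.mul_left (‖A‖ * ‖star B‖))
    calc ‖A (x n)‖ * ‖star B (y n)‖ ≤ (‖A‖ * ‖x n‖) * (‖star B‖ * ‖y n‖) := by
          gcongr <;> exact ContinuousLinearMap.le_opNorm _ _
      _ = _ := by ring
  · intro z
    have := ((hasSum_nuclear h (B z)).mapL A).tsum_eq
    simp only [map_smul] at this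
    simp only [mul_apply_eq_comp, hT, ← this, ContinuousLinearMap.star_eq_adjoint,
      ContinuousLinearMap.adjoint_inner_left]

lemma IsTraceClass.mul_mul {T : H →L[ℂ] H} (hT : IsTraceClass T) (A B : H →L[ℂ] H) :
    IsTraceClass (A * T * B) := by
  obtain ⟨x, y, h, hT⟩ := hT
  exact ⟨_, _, NucBound.mul_mul h hT A B⟩

lemma NucBound.add {S T : H →L[ℂ] H} {c d : ℝ} (hS : NucBound S c) (hT : NucBound T d) :
    NucBound (S + T) (c + d) := by
  obtain ⟨x, y, h1, h2, h3⟩ := hS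
  obtain ⟨x', y', h1', h2', h3'⟩ := hT
  let X : ℕ → H := fun n => if Even n then x (n / 2) else x' (n / 2)
  let Y : ℕ → H := fun n => if Even n then y (n / 2) else y' (n / 2)
  have e1 : ∀ n, (2 * n + 1) / 2 = n := fun n => by omega
  have hX : ∀ n, X (2 * n) = x n ∧ X (2 * n + 1) = x' n := fun n => by simp [X, e1]
  have hY : ∀ n, Y (2 * n) = y n ∧ Y (2 * n + 1) = y' n := fun n => by simp [Y, e1]
  have h : HasSum (fun n => ‖X n‖ * ‖Y n‖)
      (∑' n, ‖x n‖ * ‖y n‖ + ∑' n, ‖x' n‖ * ‖y' n‖) := by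
    refine HasSum.even_add_odd ?_ ?_
    · simpa only [hX, hY] using h1.hasSum
    · simpa only [hX, hY] using h1'.hasSum
  refine ⟨X, Y, h.summable, h.tsum_eq.trans_le (add_le_add h2 h2'), fun z => ?_⟩
  rw [add_apply, h3, h3']
  refine (HasSum.even_add_odd ?_ ?_).tsum_eq.symm
  · simpa only [hX, hY] using hasSum_nuclear h1 z
  · simpa only [hX, hY] using hasSum_nuclear h1' z

lemma NucBound.smul {T : H →L[ℂ] H} {d : ℝ} (hT : NucBound T d) (c : ℂ) :
    NucBound (c • T) (‖c‖ * d) := by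
  obtain ⟨x, y, h1, h2, h3⟩ := hT
  have h : HasSum (fun n => ‖c • x n‖ * ‖y n‖) (‖c‖ * ∑' n, ‖x n‖ * ‖y n‖) := by
    simpa only [norm_smul, mul_assoc] using h1.hasSum.mul_left ‖c‖
  refine ⟨fun n => c • x n, y, h.summable, h.tsum_eq.trans_le (by gcongr), fun z => ?_⟩
  rw [smul_apply, h3, ← ((hasSum_nuclear h1 z).const_smul c).tsum_eq]
  exact tsum_congr fun n => smul_comm _ _ _

lemma nucBound_zero : NucBound (0 : H →L[ℂ] H) 0 := by
  refine ⟨0, 0, by simp, by simp, fun z => by simp⟩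

lemma nucBound_sum {α : Type*} (s : Finset α) (T : α → H →L[ℂ] H) (c : α → ℝ)
    (h : ∀ a ∈ s, NucBound (T a) (c a)) : NucBound (∑ a ∈ s, T a) (∑ a ∈ s, c a) := by
  classical
  induction s using Finset.induction_on with
  | empty => simpa using nucBound_zero
  | insert a s ha ih =>
    rw [Finset.sum_insert ha, Finset.sum_insert ha]
    exact (h a (by simp)).add (ih fun b hb => h b (by simp [hb]))

lemma sum_norm_inner_mul_le {ι : Type*} (b : HilbertBasis ι ℂ H) (x y : H) (s : Finset ι) :
    ∑ i ∈ s, ‖⟪x, b i⟫ * ⟪b i, y⟫‖ ≤ ‖x‖ * ‖y‖ := by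
  simp only [norm_mul]
  refine (Real.sum_mul_le_sqrt_mul_sqrt _ _ _).trans ?_
  gcongr
  · rw [Real.sqrt_le_left (norm_nonneg _)]
    simp_rw [norm_inner_symm x]
    exact b.orthonormal.sum_inner_products_le x
  · rw [Real.sqrt_le_left (norm_nonneg _)]
    exact b.orthonormal.sum_inner_products_le y

lemma hasSum_tr_nuclear {ι : Type*} (b : HilbertBasis ι ℂ H) {x y : ℕ → H}
    (h : Summable fun n => ‖x n‖ * ‖y n‖) {T : H →L[ℂ] H}
    (hT : ∀ z, T z = ∑' n, ⟪y n, z⟫ • x n) :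
    HasSum (fun i => ⟪b i, T (b i)⟫) (∑' n, ⟪y n, x n⟫) := by
  have hs : Summable fun p : ℕ × ι => ⟪y p.1, b p.2⟫ * ⟪b p.2, x p.1⟫ := by
    refine Summable.of_norm ?_
    rw [summable_prod_of_nonneg fun p => norm_nonneg _]
    refine ⟨fun n => summable_of_sum_le (fun i => norm_nonneg _)
      (sum_norm_inner_mul_le b (y n) (x n)), ?_⟩
    refine Summable.of_nonneg_of_le (fun n => tsum_nonneg fun i => norm_nonneg _) (fun n => ?_) h
    refine (Real.tsum_le_of_sum_le (fun i => norm_nonneg _)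
      (sum_norm_inner_mul_le b (y n) (x n))).trans_eq (mul_comm _ _)
  have hs2 := hs.hasSum
  rw [hs.tsum_prod] at hs2
  simp only [b.tsum_inner_mul_inner] at hs2
  refine ((Equiv.prodComm ι ℕ).hasSum_iff.2 hs2).prod_fiberwise fun i => ?_
  have := (hasSum_nuclear h (b i)).mapL (innerSL ℂ (b i))
  simp only [innerSL_apply_apply, inner_smul_right, ← hT] at this
  exact this

lemma pairing_nuclear {ι : Type*} (b : HilbertBasis ι ℂ H) {x y : ℕ → H}
    (h : Summable fun n => ‖x n‖ * ‖y n‖) {T : H →L[ℂ] H}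
    (hT : ∀ z, T z = ∑' n, ⟪y n, z⟫ • x n) (A : H →L[ℂ] H) :
    HasSum (fun n => ⟪y n, A (x n)⟫) (pairing b A T) := by
  obtain ⟨h1, h2⟩ := NucBound.mul_mul h hT A 1
  simp only [star_one, one_apply_eq_self, mul_one] at h1 h2
  rw [pairing, show A ∘L T = A * T from rfl, tr, (hasSum_tr_nuclear b h1 h2).tsum_eq]
  exact (Summable.of_norm_bounded h1 fun n =>
    (norm_inner_le_norm _ _).trans_eq (mul_comm _ _)).hasSum

lemma IsTraceClass.hasSum_tr {ι : Type*} (b : HilbertBasis ι ℂ H) {T : H →L[ℂ] H}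
    (hT : IsTraceClass T) : HasSum (fun i => ⟪b i, T (b i)⟫) (tr b T) := by
  obtain ⟨x, y, h, hT⟩ := hT
  exact (hasSum_tr_nuclear b h hT).summable.hasSum

lemma pairing_add_right {ι : Type*} (b : HilbertBasis ι ℂ H) (A : H →L[ℂ] H) {S T : H →L[ℂ] H}
    (hS : IsTraceClass S) (hT : IsTraceClass T) :
    pairing b A (S + T) = pairing b A S + pairing b A T := by
  have h1 := (hS.mul_mul A 1).hasSum_tr b
  have h2 := (hT.mul_mul A 1).hasSum_tr b
  rw [mul_one] at h1 h2
  refine Eq.trans ?_ (h1.add h2).tsum_eq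
  refine tsum_congr fun i => ?_
  simp

lemma pairing_add_left {ι : Type*} (b : HilbertBasis ι ℂ H) (A B : H →L[ℂ] H) {T : H →L[ℂ] H}
    (hT : IsTraceClass T) :
    pairing b (A + B) T = pairing b A T + pairing b B T := by
  have h1 := (hT.mul_mul A 1).hasSum_tr b
  have h2 := (hT.mul_mul B 1).hasSum_tr b
  rw [mul_one] at h1 h2
  refine Eq.trans ?_ (h1.add h2).tsum_eq
  refine tsum_congr fun i => ?_
  simp

lemma pairing_smul_right {ι : Type*} (b : HilbertBasis ι ℂ H) (c : ℂ) (A T : H →L[ℂ] H) :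
    pairing b A (c • T) = c * pairing b A T := by
  simp [pairing, tr, tsum_mul_left]

lemma pairing_smul_left {ι : Type*} (b : HilbertBasis ι ℂ H) (c : ℂ) (A T : H →L[ℂ] H) :
    pairing b (c • A) T = c * pairing b A T := by
  simp [pairing, tr, tsum_mul_left]

lemma pairing_sum_left {ι α : Type*} (b : HilbertBasis ι ℂ H) (s : Finset α)
    (A : α → H →L[ℂ] H) {T : H →L[ℂ] H} (hT : IsTraceClass T) :
    pairing b (∑ a ∈ s, A a) T = ∑ a ∈ s, pairing b (A a) T := by
  classical
  induction s using Finset.induction_on with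
  | empty => simpa using pairing_smul_left b 0 0 T
  | insert a s ha ih => rw [Finset.sum_insert ha, Finset.sum_insert ha, pairing_add_left b _ _ hT, ih]

lemma pairing_sum_right {ι α : Type*} (b : HilbertBasis ι ℂ H) (s : Finset α)
    (A : H →L[ℂ] H) {T : α → H →L[ℂ] H} (hT : ∀ a, IsTraceClass (T a)) :
    pairing b A (∑ a ∈ s, T a) = ∑ a ∈ s, pairing b A (T a) := by
  classical
  induction s using Finset.induction_on with
  | empty => simpa using pairing_smul_right b 0 A 0
  | insert a s ha ih =>
    rw [Finset.sum_insert ha, Finset.sum_insert ha, pairing_add_right b _ (hT a), ih]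
    exact (nucBound_sum s T _ fun a _ => (isTraceClass_iff_nucBound.1 (hT a)).choose_spec).isTraceClass

lemma pairing_rankOne_left {ι : Type*} (b : HilbertBasis ι ℂ H) (x y : H) (T : H →L[ℂ] H) :
    pairing b (rankOne x y) T = ⟪y, T x⟫ := by
  rw [← ContinuousLinearMap.adjoint_inner_left, ← b.tsum_inner_mul_inner]
  refine tsum_congr fun i => ?_
  rw [ContinuousLinearMap.comp_apply, inner_rankOne, ContinuousLinearMap.adjoint_inner_left,
    mul_comm]

lemma pairing_rankOne_right {ι : Type*} (b : HilbertBasis ι ℂ H) (x y : H) (A : H →L[ℂ] H) :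
    pairing b A (rankOne x y) = ⟪y, A x⟫ := by
  rw [← b.tsum_inner_mul_inner]
  refine tsum_congr fun i => ?_
  rw [ContinuousLinearMap.comp_apply, rankOne_apply, map_smul, inner_smul_right]

lemma norm_pairing_le {ι : Type*} (b : HilbertBasis ι ℂ H) (A : H →L[ℂ] H) {T : H →L[ℂ] H}
    {c : ℝ} (hT : NucBound T c) : ‖pairing b A T‖ ≤ ‖A‖ * c := by
  obtain ⟨x, y, h1, h2, h3⟩ := hT
  rw [← (pairing_nuclear b h1 h3 A).tsum_eq]
  refine (tsum_of_norm_bounded (h1.hasSum.mul_left ‖A‖) fun n => ?_).trans (by gcongr)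
  calc ‖⟪y n, A (x n)⟫‖ ≤ ‖y n‖ * (‖A‖ * ‖x n‖) :=
        (norm_inner_le_norm _ _).trans (by gcongr; exact A.le_opNorm _)
    _ = _ := by ring

end TraceClass

section HilbertSchmidt

set_option linter.unusedSectionVars false

lemma isHS_rankOne (e : HilbertBasis ι ℂ K) (u v : K) : IsHS e (rankOne u v) := by
  have h : Summable fun i => ‖⟪e i, v⟫‖ ^ 2 := e.orthonormal.inner_products_summable v
  refine (h.mul_right (‖u‖ ^ 2)).congr fun i => ?_
  rw [rankOne_apply, norm_smul, mul_pow, norm_inner_symm]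

lemma denseRange_of_orthogonal {T : K →L[ℂ] K} (h : ∀ u, (∀ v, ⟪u, T v⟫ = 0) → u = 0) :
    DenseRange T := by
  have : (LinearMap.range (T : K →ₗ[ℂ] K)).topologicalClosure = ⊤ := by
    rw [Submodule.topologicalClosure_eq_top_iff, Submodule.eq_bot_iff]
    intro u hu
    refine h u fun v => ?_
    rw [Submodule.mem_orthogonal'] at hu
    exact hu _ ⟨v, rfl⟩
  rw [← Submodule.dense_iff_topologicalClosure_eq_top] at this
  exact this

namespace HSModel

variable (m : HSModel e H)

/-- The vector of `H` corresponding to the rank one operator `rankOne u v`. -/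
def elem : K →ₗ[ℂ] K →ₗ⋆[ℂ] H :=
  LinearMap.mk₂'ₛₗ (RingHom.id ℂ) (starRingEnd ℂ)
    (fun u v => ((m.mem_range (rankOne u v)).1 (isHS_rankOne e u v)).choose)
    (fun u u' v => m.inj (by
      rw [map_add]
      simp only [((m.mem_range (rankOne _ v)).1 (isHS_rankOne e _ v)).choose_spec]
      ext z; simp [rankOne_apply]))
    (fun c u v => m.inj (by
      rw [map_smul]
      simp only [((m.mem_range (rankOne _ v)).1 (isHS_rankOne e _ v)).choose_spec]
      ext z; simp [rankOne_apply, smul_comm c]))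
    (fun u v v' => m.inj (by
      rw [map_add]
      simp only [((m.mem_range (rankOne u _)).1 (isHS_rankOne e u _)).choose_spec]
      ext z; simp [rankOne_apply, add_smul]))
    (fun c u v => m.inj (by
      rw [map_smul]
      simp only [((m.mem_range (rankOne u _)).1 (isHS_rankOne e u _)).choose_spec]
      ext z; simp [rankOne_apply, mul_smul, smul_comm ⟪v, z⟫]))

lemma toOp_elem (u v : K) : m.toOp (m.elem u v) = rankOne u v :=
  ((m.mem_range (rankOne u v)).1 (isHS_rankOne e u v)).choose_spec

lemma inner_elem_right (x : H) (u v : K) : ⟪x, m.elem u v⟫ = ⟪m.toOp x v, u⟫ := by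
  rw [m.inner_eq, toOp_elem, ← ContinuousLinearMap.adjoint_inner_right, ← e.tsum_inner_mul_inner]
  refine tsum_congr fun i => ?_
  rw [inner_rankOne, ContinuousLinearMap.adjoint_inner_right, mul_comm]

lemma inner_elem_left (x : H) (u v : K) : ⟪m.elem u v, x⟫ = ⟪u, m.toOp x v⟫ := by
  rw [← inner_conj_symm, inner_elem_right, inner_conj_symm]

lemma Lmul_elem (a : K →L[ℂ] K) (u v : K) : m.Lmul a (m.elem u v) = m.elem (a u) v := by
  refine m.inj ?_
  rw [m.Lmul_eq, toOp_elem, toOp_elem]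
  ext z
  simp [rankOne_apply]

lemma Lmul_rankOne_apply (u h : K) (x : H) :
    m.Lmul (rankOne u h) x = m.elem u (adjoint (m.toOp x) h) := by
  refine m.inj ?_
  rw [m.Lmul_eq, toOp_elem]
  ext z
  simp [rankOne_apply, ContinuousLinearMap.adjoint_inner_left]

lemma Rmul_rankOne_apply (u v : K) (x : H) :
    m.Rmul (rankOne u v) x = m.elem (m.toOp x u) v := by
  refine m.inj ?_
  rw [m.Rmul_eq, toOp_elem]
  ext z
  simp [rankOne_apply]

lemma Lmul_add (a b : K →L[ℂ] K) : m.Lmul (a + b) = m.Lmul a + m.Lmul b := by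
  ext x
  refine m.inj ?_
  simp [m.Lmul_eq, ContinuousLinearMap.add_comp]

lemma Lmul_smul (c : ℂ) (a : K →L[ℂ] K) : m.Lmul (c • a) = c • m.Lmul a := by
  ext x
  refine m.inj ?_
  simp [m.Lmul_eq, ContinuousLinearMap.smul_comp]

lemma Lmul_mul (a b : K →L[ℂ] K) : m.Lmul (a * b) = m.Lmul a * m.Lmul b := by
  ext x
  refine m.inj ?_
  simp only [m.Lmul_eq, mul_apply_eq_comp]
  rfl

lemma Lmul_mul_Rmul (a b : K →L[ℂ] K) : m.Lmul a * m.Rmul b = m.Rmul b * m.Lmul a := by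
  ext x
  refine m.inj ?_
  simp only [m.Lmul_eq, m.Rmul_eq, mul_apply_eq_comp]
  rfl

lemma star_Lmul (a : K →L[ℂ] K) : star (m.Lmul a) = m.Lmul (star a) := by
  rw [ContinuousLinearMap.star_eq_adjoint, ContinuousLinearMap.star_eq_adjoint, eq_comm,
    ContinuousLinearMap.eq_adjoint_iff]
  intro x y
  simp [m.inner_eq, m.Lmul_eq, ContinuousLinearMap.adjoint_inner_left]

variable {m} {x0 : H}

lemma toOp_injective_of_cyclic (hcyc : Dense {y : H | ∃ a : K →L[ℂ] K, m.Lmul a x0 = y})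
    {h : K} (hh : m.toOp x0 h = 0) : h = 0 := by
  have h0 : m.elem h h = 0 := by
    refine hcyc.eq_zero_of_inner_right (𝕜 := ℂ) ?_
    rintro _ ⟨a, rfl⟩
    rw [inner_elem_right, m.Lmul_eq, ContinuousLinearMap.comp_apply, hh, map_zero, inner_zero_left]
  have h1 := congrArg (fun T => m.toOp T h) h0
  simp only [toOp_elem, rankOne_apply, map_zero, zero_apply] at h1
  rcases smul_eq_zero.1 h1 with h | h
  · exact inner_self_eq_zero.1 h
  · exact h

lemma denseRange_toOp_of_separating (hsep : ∀ a : K →L[ℂ] K, m.Lmul a x0 = 0 → m.Lmul a = 0) :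
    DenseRange (m.toOp x0) := by
  refine denseRange_of_orthogonal fun u hu => ?_
  have h0 : m.Lmul (rankOne u u) x0 = 0 := by
    refine m.inj ?_
    rw [m.Lmul_eq, map_zero]
    ext v
    simp [rankOne_apply, hu v]
  have h1 := congrArg (fun T => m.toOp (T (m.elem u u)) u) (hsep _ h0)
  simp only [Lmul_elem, toOp_elem, rankOne_apply, zero_apply, map_zero, smul_eq_zero,
    inner_self_eq_zero] at h1
  tauto

lemma denseRange_adjoint_of_cyclic
    (hcyc : Dense {y : H | ∃ a : K →L[ℂ] K, m.Lmul a x0 = y}) :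
    DenseRange (adjoint (m.toOp x0)) := by
  refine denseRange_of_orthogonal fun u hu => toOp_injective_of_cyclic hcyc ?_
  refine inner_self_eq_zero (𝕜 := ℂ).1 ?_
  rw [← ContinuousLinearMap.adjoint_inner_right]
  exact hu _

variable (m) in
/-- The tensors built from two families of vectors of `K`. -/
def tensor {α β : Type*} (f : α → K) (g : β → K) (p : α × β) : H := m.elem (f p.1) (g p.2)

lemma orthonormal_tensor {α β : Type*} {f : α → K} {g : β → K}
    (hf : Orthonormal ℂ f) (hg : Orthonormal ℂ g) : Orthonormal ℂ (m.tensor f g) := by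
  classical
  rw [orthonormal_iff_ite] at hf hg ⊢
  rintro ⟨i, j⟩ ⟨i', j'⟩
  simp only [tensor, inner_elem_right, toOp_elem, rankOne_apply, inner_smul_left, hf, hg,
    Prod.mk.injEq]
  by_cases h1 : i = i' <;> by_cases h2 : j = j' <;> simp [h1, h2]

lemma elem_mem_span_tensor {α β : Type*} {f : α → K} {g : β → K} {u v : K}
    (hu : u ∈ Submodule.span ℂ (Set.range f)) (hv : v ∈ Submodule.span ℂ (Set.range g)) :
    m.elem u v ∈ Submodule.span ℂ (Set.range (m.tensor f g)) := by
  induction hu using Submodule.span_induction with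
  | mem u hu =>
    obtain ⟨i, rfl⟩ := hu
    induction hv using Submodule.span_induction with
    | mem v hv =>
      obtain ⟨j, rfl⟩ := hv
      exact Submodule.subset_span ⟨(i, j), rfl⟩
    | zero => simp
    | add v w _ _ h1 h2 => rw [map_add]; exact add_mem h1 h2
    | smul c v _ h => rw [LinearMap.map_smulₛₗ]; exact Submodule.smul_mem _ _ h
  | zero => simp
  | add v w _ _ h1 h2 => rw [map_add]; exact add_mem h1 h2
  | smul c v _ h => rw [map_smul]; exact Submodule.smul_mem _ _ h

end HSModel

lemma starProjection_span_range {α : Type*} [Fintype α] {U : α → H} (hU : Orthonormal ℂ U)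
    [(Submodule.span ℂ (Set.range U)).HasOrthogonalProjection] :
    (Submodule.span ℂ (Set.range U)).starProjection = ∑ p, rankOne (U p) (U p) := by
  ext x
  refine Submodule.eq_starProjection_of_mem_of_inner_eq_zero ?_ fun w hw => ?_
  · simp only [sum_apply, rankOne_apply]
    exact Submodule.sum_mem _ fun p _ => Submodule.smul_mem _ _ (Submodule.subset_span ⟨p, rfl⟩)
  · induction hw using Submodule.span_induction with
    | mem u hu =>
      obtain ⟨q, rfl⟩ := hu
      simp only [sum_apply, rankOne_apply, inner_sub_left]
      rw [hU.inner_left_fintype]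
      simp
    | zero => simp
    | add v w _ _ h1 h2 => rw [inner_add_right, h1, h2, add_zero]
    | smul c v _ h => rw [inner_smul_right, h, mul_zero]

/-- Elementary tensors whose right leg lies in a dense set span a dense subspace. -/
lemma HSModel.dense_span_elem (m : HSModel e H) {s : Set K} (hs : Dense s) :
    (Submodule.span ℂ {z | ∃ u, ∃ v ∈ s, m.elem u v = z}).topologicalClosure = ⊤ := by
  rw [Submodule.topologicalClosure_eq_top_iff, Submodule.eq_bot_iff]
  intro w hw
  rw [Submodule.mem_orthogonal'] at hw
  refine m.inj ?_
  rw [map_zero]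
  refine DFunLike.coe_injective ?_
  refine Continuous.ext_on hs (m.toOp w).continuous continuous_zero fun v hv => ?_
  refine inner_self_eq_zero (𝕜 := ℂ).1 ?_
  rw [← m.inner_elem_right]
  exact hw _ (Submodule.subset_span ⟨_, v, hv, rfl⟩)

end HilbertSchmidt

section Truncation

set_option linter.unusedSectionVars false

lemma nucBound_sub_proj_mul_mul_proj {R P : H →L[ℂ] H} {x y : ℕ → H}
    (h : Summable fun n => ‖x n‖ * ‖y n‖) (hR : ∀ z, R z = ∑' n, ⟪y n, z⟫ • x n)
    (hP : IsSelfAdjoint P) (hP1 : ∀ z, ‖P z‖ ≤ ‖z‖) :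
    NucBound (R - P * R * P)
      (∑' n, ‖x n - P (x n)‖ * ‖y n‖ + ∑' n, ‖x n‖ * ‖y n - P (y n)‖) := by
  have hb : ∀ z, ‖z - P z‖ ≤ 2 * ‖z‖ := fun z => by
    linarith [norm_sub_le z (P z), hP1 z]
  have h1 := NucBound.mul_mul h hR (1 - P) 1
  have h2 := NucBound.mul_mul h hR P (1 - P)
  have h3 : Summable fun n => ‖x n‖ * ‖y n - P (y n)‖ :=
    Summable.of_nonneg_of_le (fun n => by positivity)
      (fun n => (mul_le_mul_of_nonneg_left (hb _) (norm_nonneg _)).trans_eq (by ring))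
      (h.mul_left 2)
  have e : R - P * R * P = (1 - P) * R * 1 + P * R * (1 - P) := by noncomm_ring
  rw [e]
  refine NucBound.add ⟨_, _, h1.1, ?_, h1.2⟩ ⟨_, _, h2.1, ?_, h2.2⟩
  · simp
  · refine h2.1.tsum_le_tsum (fun n => ?_) h3
    gcongr
    · exact hP1 _
    · rw [star_sub, star_one, hP.star_eq]; simp

/-- Trace class operators are approximated in trace norm by their compressions along an
increasing net of projections with dense union of ranges. -/
lemma tendsto_nuclear_defect {α : Type*} [Preorder α] (W : α → Submodule ℂ H)
    [∀ a, (W a).HasOrthogonalProjection] (hW : Monotone W)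
    (hd : ⊤ ≤ (⨆ a, W a).topologicalClosure) {x y : ℕ → H}
    (h : Summable fun n => ‖x n‖ * ‖y n‖) :
    Filter.Tendsto (fun a => ∑' n, ‖x n - (W a).starProjection (x n)‖ * ‖y n‖ +
      ∑' n, ‖x n‖ * ‖y n - (W a).starProjection (y n)‖) Filter.atTop (nhds 0) := by
  have hb : ∀ a z, ‖z - (W a).starProjection z‖ ≤ 2 * ‖z‖ := fun a z => by
    linarith [norm_sub_le z ((W a).starProjection z), (W a).norm_starProjection_apply_le z]
  have ht : ∀ z, Filter.Tendsto (fun a => ‖z - (W a).starProjection z‖) Filter.atTop (nhds 0) :=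
    fun z => by
      simpa using ((Submodule.starProjection_tendsto_self W hW z hd).const_sub z).norm
  rw [← add_zero (0 : ℝ)]
  refine Filter.Tendsto.add ?_ ?_
  · rw [← tsum_zero (α := ℝ) (β := ℕ)]
    refine tendsto_tsum_of_dominated_convergence (h.mul_left 2) (fun n => ?_)
      (Filter.Eventually.of_forall fun a n => ?_)
    · simpa using (ht (x n)).mul_const ‖y n‖
    · rw [Real.norm_of_nonneg (by positivity), ← mul_assoc]
      gcongr
      exact hb _ _
  · rw [← tsum_zero (α := ℝ) (β := ℕ)]
    refine tendsto_tsum_of_dominated_convergence (h.mul_left 2) (fun n => ?_)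
      (Filter.Eventually.of_forall fun a n => ?_)
    · simpa using (ht (y n)).const_mul ‖x n‖
    · rw [Real.norm_of_nonneg (by positivity)]
      exact (mul_le_mul_of_nonneg_left (hb _ _) (norm_nonneg _)).trans_eq (by ring)

lemma compression_eq_sum {α : Type*} [Fintype α] (U : α → H) (R : H →L[ℂ] H) :
    (∑ p, rankOne (U p) (U p)) * R * (∑ p, rankOne (U p) (U p)) =
      ∑ p, ∑ q, ⟪U p, R (U q)⟫ • rankOne (U p) (U q) := by
  ext z
  simp only [mul_apply_eq_comp, sum_apply, rankOne_apply, smul_apply, map_sum, map_smul,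
    Finset.smul_sum, smul_smul]
  rw [Finset.sum_comm]
  refine Finset.sum_congr rfl fun p _ => Finset.sum_congr rfl fun q _ => ?_
  rw [mul_comm]

lemma exists_truncation (m : HSModel e H) {V : Submodule ℂ K} (hV : Dense (V : Set K))
    {R : H →L[ℂ] H} (hR : IsTraceClass R) {ε : ℝ} (hε : 0 < ε) :
    ∃ (a b : ℕ) (f : Fin a → K) (g : Fin b → K), Orthonormal ℂ f ∧ Orthonormal ℂ g ∧
      (∀ j, g j ∈ V) ∧
      NucBound (R - ∑ p, ∑ q, ⟪m.tensor f g p, R (m.tensor f g q)⟫ •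
        rankOne (m.tensor f g p) (m.tensor f g q)) ε := by
  classical
  obtain ⟨x, y, h, hR⟩ := hR
  let F : Finset (K × V) → Submodule ℂ K := fun S => Submodule.span ℂ (S.image fun p => p.1)
  let G : Finset (K × V) → Submodule ℂ K :=
    fun S => Submodule.span ℂ (S.image fun p => (p.2 : K))
  have hFG : Monotone F ∧ Monotone G :=
    ⟨fun S T hST => Submodule.span_mono (by exact_mod_cast Finset.image_subset_image hST),
      fun S T hST => Submodule.span_mono (by exact_mod_cast Finset.image_subset_image hST)⟩
  have hGV : ∀ S, G S ≤ V := fun S => by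
    refine Submodule.span_le.2 fun z hz => ?_
    obtain ⟨p, -, rfl⟩ := Finset.mem_image.1 (Finset.mem_coe.1 hz)
    exact p.2.2
  have hFf : ∀ S, FiniteDimensional ℂ (F S) := fun S => FiniteDimensional.span_finset ℂ _
  have hGf : ∀ S, FiniteDimensional ℂ (G S) := fun S => FiniteDimensional.span_finset ℂ _
  let f : ∀ S, Fin (Module.finrank ℂ (F S)) → K := fun S i => stdOrthonormalBasis ℂ (F S) i
  let g : ∀ S, Fin (Module.finrank ℂ (G S)) → K := fun S i => stdOrthonormalBasis ℂ (G S) i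
  have hfo : ∀ S, Orthonormal ℂ (f S) := fun S =>
    (stdOrthonormalBasis ℂ (F S)).orthonormal.comp_linearIsometry (F S).subtypeₗᵢ
  have hgo : ∀ S, Orthonormal ℂ (g S) := fun S =>
    (stdOrthonormalBasis ℂ (G S)).orthonormal.comp_linearIsometry (G S).subtypeₗᵢ
  have hspan : ∀ (F : Submodule ℂ K) [FiniteDimensional ℂ F],
      Submodule.span ℂ (Set.range fun i => (stdOrthonormalBasis ℂ F i : K)) = F := fun F _ => by
    have := (stdOrthonormalBasis ℂ F).toBasis.span_eq
    rw [OrthonormalBasis.coe_toBasis] at this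
    have h2 := congrArg (Submodule.map F.subtype) this
    rw [Submodule.map_span, ← Set.range_comp, Submodule.map_top, Submodule.range_subtype] at h2
    exact h2
  have hfs : ∀ S, Submodule.span ℂ (Set.range (f S)) = F S := fun S => hspan (F S)
  have hgs : ∀ S, Submodule.span ℂ (Set.range (g S)) = G S := fun S => hspan (G S)
  let W : Finset (K × V) → Submodule ℂ H := fun S =>
    Submodule.span ℂ (Set.range (m.tensor (f S) (g S)))
  have hWf : ∀ S, FiniteDimensional ℂ (W S) := fun S =>
    FiniteDimensional.span_of_finite ℂ (Set.finite_range _)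
  have hmem : ∀ S u v, u ∈ F S → v ∈ G S → m.elem u v ∈ W S := fun S u v hu hv =>
    HSModel.elem_mem_span_tensor (by rwa [hfs]) (by rwa [hgs])
  have hW : Monotone W := fun S T hST => by
    refine Submodule.span_le.2 ?_
    rintro _ ⟨p, rfl⟩
    refine hmem T _ _ (hFG.1 hST ?_) (hFG.2 hST ?_)
    · exact (stdOrthonormalBasis ℂ (F S) p.1).2
    · exact (stdOrthonormalBasis ℂ (G S) p.2).2
  have hd : ⊤ ≤ (⨆ S, W S).topologicalClosure := by
    rw [← m.dense_span_elem hV]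
    refine Submodule.topologicalClosure_mono (Submodule.span_le.2 ?_)
    rintro _ ⟨u, v, hv, rfl⟩
    refine Submodule.mem_iSup_of_mem {(u, ⟨v, hv⟩)} (hmem _ _ _ ?_ ?_)
    · exact Submodule.subset_span (by simp)
    · exact Submodule.subset_span (by simp)
  obtain ⟨S, hS⟩ := ((tendsto_nuclear_defect W hW hd h).eventually_lt_const hε).exists
  refine ⟨_, _, f S, g S, hfo S, hgo S, fun j => hGV S (stdOrthonormalBasis ℂ (G S) j).2, ?_⟩
  have hn := nucBound_sub_proj_mul_mul_proj h hR (isSelfAdjoint_starProjection (W S))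
    (W S).norm_starProjection_apply_le
  rw [← compression_eq_sum, ← starProjection_span_range
    (HSModel.orthonormal_tensor (m := m) (hfo S) (hgo S))]
  exact hn.mono hS.le

end Truncation

section Necessity

set_option linter.unusedSectionVars false

lemma rankLE_iff {T : K →L[ℂ] K} {k : ℕ} :
    rankLE T k ↔ ∃ f : Fin k → K, ∀ v, T v ∈ Submodule.span ℂ (Set.range f) := by
  constructor
  · intro h
    let r := LinearMap.range (T : K →ₗ[ℂ] K)
    have hfin : FiniteDimensional ℂ r :=
      Module.rank_lt_aleph0_iff.1 (lt_of_le_of_lt h (Cardinal.natCast_lt_aleph0 (n := k)))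
    have hk : Module.finrank ℂ r ≤ k := Module.finrank_le_of_rank_le h
    let b := Module.finBasis ℂ r
    refine ⟨fun i => if hi : (i : ℕ) < Module.finrank ℂ r then (b ⟨i, hi⟩ : K) else 0,
      fun v => ?_⟩
    have hv := b.sum_repr ⟨T v, v, rfl⟩
    have hv' := congrArg (r.subtype) hv
    rw [map_sum] at hv'
    change _ = T v at hv'
    rw [← hv']
    refine Submodule.sum_mem _ fun i _ => ?_
    rw [map_smul]
    refine Submodule.smul_mem _ _ (Submodule.subset_span ⟨⟨i, i.2.trans_le hk⟩, ?_⟩)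
    simp
  · rintro ⟨f, hf⟩
    refine (Submodule.rank_mono (t := Submodule.span ℂ (Set.range f)) ?_).trans ?_
    · rintro _ ⟨v, rfl⟩
      exact hf v
    · refine (rank_span_le _).trans ?_
      simpa using Cardinal.mk_range_le_lift (f := f)

lemma sum_sum_comm_sum_sum {α β : Type*} [Fintype α] [Fintype β] (F : α → α → β → β → ℂ) :
    ∑ i, ∑ j, ∑ p, ∑ q, F i j p q = ∑ p, ∑ q, ∑ i, ∑ j, F i j p q := by
  calc _ = ∑ i, ∑ p, ∑ j, ∑ q, F i j p q := Finset.sum_congr rfl fun _ _ => Finset.sum_comm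
    _ = ∑ p, ∑ i, ∑ j, ∑ q, F i j p q := Finset.sum_comm
    _ = ∑ p, ∑ i, ∑ q, ∑ j, F i j p q :=
        Finset.sum_congr rfl fun _ _ => Finset.sum_congr rfl fun _ _ => Finset.sum_comm
    _ = _ := Finset.sum_congr rfl fun _ _ => Finset.sum_comm

lemma rankOne_sum_sum {α β : Type*} (s : Finset α) (t : Finset β) (x : α → H) (y : β → H) :
    rankOne (∑ a ∈ s, x a) (∑ b ∈ t, y b) = ∑ a ∈ s, ∑ b ∈ t, rankOne (x a) (y b) := by
  ext z
  simp only [rankOne_apply, sum_apply, sum_inner, Finset.sum_smul, Finset.smul_sum]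

lemma rankOne_smul_smul (c d : ℂ) (x y : H) :
    rankOne (c • x) (d • y) = (c * starRingEnd ℂ d) • rankOne x y := by
  ext z
  simp [rankOne_apply, smul_smul, mul_comm, mul_left_comm]

lemma matPos_rankOne {k : ℕ} (ξ : Fin k → H) : MatPos fun i j => rankOne (ξ i) (ξ j) := by
  intro v
  have : ∑ i, ∑ j, ⟪v i, rankOne (ξ i) (ξ j) (v j)⟫ =
      star (∑ i, ⟪ξ i, v i⟫) * ∑ i, ⟪ξ i, v i⟫ := by
    simp [inner_rankOne, Finset.sum_mul_sum]
  rw [this]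
  exact star_mul_self_nonneg _

lemma rankOne_elem_elem (m : HSModel e H) (u v u' v' : K) :
    rankOne (m.elem u v) (m.elem u' v') =
      m.Rmul (rankOne v' v) ∘L m.Lmul (rankOne u u') := by
  ext z
  rw [ContinuousLinearMap.comp_apply, m.Lmul_rankOne_apply, m.Rmul_rankOne_apply, m.toOp_elem,
    rankOne_apply, rankOne_apply, map_smul, LinearMap.smul_apply,
    ContinuousLinearMap.adjoint_inner_left, m.inner_elem_left]

/-- The form of a `k`-positive map on an operator of rank at most `k` is positive. -/
lemma kPos.sum_inner_nonneg {k : ℕ} {φ : (K →L[ℂ] K) →ₗ[ℂ] (K →L[ℂ] K)} (hφ : kPos k φ)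
    {T : K →L[ℂ] K} (hT : rankLE T k) {n : ℕ} (u v : Fin n → K) :
    0 ≤ ∑ a, ∑ b, ⟪T (v a), φ (rankOne (u a) (u b)) (T (v b))⟫ := by
  obtain ⟨f, hf⟩ := rankLE_iff.1 hT
  choose C hC using fun a => (Submodule.mem_span_range_iff_exists_fun ℂ).1 (hf (v a))
  have h := hφ _ (matPos_rankOne fun i => ∑ a, starRingEnd ℂ (C a i) • u a) f
  refine h.trans_eq ?_
  simp only [rankOne_sum_sum, rankOne_smul_smul, map_sum, map_smul, sum_apply, smul_apply,
    inner_sum, inner_smul_right, ← hC, sum_inner, inner_smul_left, Complex.conj_conj]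
  rw [sum_sum_comm_sum_sum]
  refine Finset.sum_congr rfl fun _ _ => Finset.sum_congr rfl fun _ _ => ?_
  simp only [mul_assoc, Finset.mul_sum]
  rw [Finset.sum_comm]
  exact Finset.sum_congr rfl fun _ _ => Finset.sum_congr rfl fun _ _ => by ring

lemma inner_choi_nonneg {ιH : Type*} {bH : HilbertBasis ιH ℂ H} {m : HSModel e H} {k : ℕ}
    {φ : (K →L[ℂ] K) →ₗ[ℂ] (K →L[ℂ] K)} {Φ Φst : (H →L[ℂ] H) →ₗ[ℂ] (H →L[ℂ] H)}
    (hφ : kPos k φ) (hΦ : HSExt m φ Φ) (hn : IsNormalPair bH Φ Φst) {x : H}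
    (hx : rankLE (m.toOp x) k) (z : H) : 0 ≤ ⟪x, Φ (rankOne z z) x⟫ := by
  have hst : ∀ z, ⟪x, Φ (rankOne z z) x⟫ = ⟪z, Φst (rankOne x x) z⟫ := fun z => by
    rw [← pairing_rankOne_right bH, hn.2 _ _ (nucBound_rankOne x x).isTraceClass,
      pairing_rankOne_left]
  have hclosed : IsClosed {z : H | 0 ≤ ⟪x, Φ (rankOne z z) x⟫} := by
    simp only [hst]
    exact isClosed_le continuous_const (by fun_prop)
  have hdense := m.dense_span_elem dense_univ
  rw [← Submodule.dense_iff_topologicalClosure_eq_top] at hdense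
  refine hclosed.closure_subset_iff.2 ?_ (hdense z)
  intro z hz
  obtain ⟨n, c, w, rfl⟩ := (Submodule.mem_span_set').1 hz
  choose u v _ huv using fun a => (w a).2
  refine (hφ.sum_inner_nonneg hx (fun a => c a • u a) v).trans_eq ?_
  simp only [rankOne_sum_sum, rankOne_smul_smul, map_sum, map_smul, ← huv, rankOne_elem_elem,
    hΦ _ _, sum_apply, smul_apply, inner_sum, inner_smul_right, ContinuousLinearMap.comp_apply,
    m.Rmul_rankOne_apply, m.inner_elem_right, m.Lmul_eq]

lemma pairing_nonneg_of_mem_schmidtCone {ιH : Type*} (bH : HilbertBasis ιH ℂ H)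
    {m : HSModel e H} {k : ℕ} {A R : H →L[ℂ] H} (hR : IsTraceClass R)
    (hRS : R ∈ SchmidtCone m k) (hA : ∀ x, rankLE (m.toOp x) k → 0 ≤ ⟪x, A x⟫) :
    0 ≤ pairing bH A R := by
  have hcl : IsClosed {z : ℂ | 0 ≤ z} := isClosed_le continuous_const continuous_id
  refine hcl.closure_subset (s := {z : ℂ | 0 ≤ z}) (Metric.mem_closure_iff.2 fun ε hε => ?_)
  have hpos : 0 < ‖A‖ + 1 := by positivity
  obtain ⟨n, x, hx, hlt⟩ := hRS (ε / (‖A‖ + 1)) (by positivity)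
  have hS : IsTraceClass (∑ i, rankOne (x i) (x i)) :=
    (nucBound_sum _ _ _ fun i _ => nucBound_rankOne (x i) (x i)).isTraceClass
  have hD : IsTraceClass (R - ∑ i, rankOne (x i) (x i)) := by
    obtain ⟨c, hc⟩ := isTraceClass_iff_nucBound.1 hR
    obtain ⟨d, hd⟩ := isTraceClass_iff_nucBound.1 hS
    rw [sub_eq_add_neg, ← neg_one_smul ℂ]
    exact (hc.add (hd.smul (-1))).isTraceClass
  refine ⟨pairing bH A (∑ i, rankOne (x i) (x i)), ?_, ?_⟩
  · rw [Set.mem_ofPred_eq, pairing_sum_right bH _ _ fun i => (nucBound_rankOne _ _).isTraceClass]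
    refine Finset.sum_nonneg fun i _ => ?_
    rw [pairing_rankOne_right]
    exact hA _ (hx i)
  · have h1 := pairing_add_right bH A hD hS
    rw [sub_add_cancel] at h1
    rw [dist_eq_norm, h1, add_sub_cancel_right]
    calc _ ≤ ‖A‖ * (ε / (‖A‖ + 1)) := norm_pairing_le bH A (hD.nucBound hlt)
      _ < (‖A‖ + 1) * (ε / (‖A‖ + 1)) := by gcongr; linarith
      _ = ε := by field_simp

end Necessity

section Elementary

set_option linter.unusedSectionVars false

lemma isNormalPair_mulLeftRight {ι : Type*} (b : HilbertBasis ι ℂ H) (A B : H →L[ℂ] H) :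
    IsNormalPair b (LinearMap.mulLeftRight ℂ (A, B)) (LinearMap.mulLeftRight ℂ (B, A)) := by
  refine ⟨fun T hT => ?_, fun X T hT => ?_⟩
  · simpa using hT.mul_mul B A
  · obtain ⟨x, y, h, hT⟩ := hT
    obtain ⟨h1, h2⟩ := NucBound.mul_mul h hT B A
    rw [LinearMap.mulLeftRight_apply, LinearMap.mulLeftRight_apply]
    refine (pairing_nuclear b h hT (A * X * B)).unique
      ((pairing_nuclear b h1 h2 X).congr_fun fun n => ?_)
    rw [ContinuousLinearMap.star_eq_adjoint, ContinuousLinearMap.adjoint_inner_left]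
    rfl

lemma isNormalPair_sum_smul {ι α : Type*} (b : HilbertBasis ι ℂ H) (s : Finset α) (c : α → ℂ)
    {Φ Φst : α → (H →L[ℂ] H) →ₗ[ℂ] (H →L[ℂ] H)} (h : ∀ a, IsNormalPair b (Φ a) (Φst a)) :
    IsNormalPair b (∑ a ∈ s, c a • Φ a) (∑ a ∈ s, c a • Φst a) := by
  have hst : ∀ T, IsTraceClass T → ∀ a, IsTraceClass (c a • Φst a T) := fun T hT a => by
    obtain ⟨d, hd⟩ := isTraceClass_iff_nucBound.1 ((h a).1 T hT)
    exact (hd.smul _).isTraceClass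
  refine ⟨fun T hT => ?_, fun A T hT => ?_⟩
  · simp only [LinearMap.sum_apply, LinearMap.smul_apply]
    choose d hd using fun a => isTraceClass_iff_nucBound.1 (hst T hT a)
    exact (nucBound_sum s _ _ fun a _ => hd a).isTraceClass
  · simp only [LinearMap.sum_apply, LinearMap.smul_apply]
    rw [pairing_sum_left b s _ hT, pairing_sum_right b s _ (hst T hT)]
    refine Finset.sum_congr rfl fun a _ => ?_
    rw [pairing_smul_left, pairing_smul_right, (h a).2 A T hT]

lemma sqrt_sum_norm_apply_le {k : ℕ} (T : K →L[ℂ] K) (v : Fin k → K) :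
    Real.sqrt (∑ i, ‖T (v i)‖ ^ 2) ≤ ‖T‖ * Real.sqrt (∑ i, ‖v i‖ ^ 2) := by
  refine Real.sqrt_le_iff.2 ⟨by positivity, ?_⟩
  rw [mul_pow, Real.sq_sqrt (by positivity), Finset.mul_sum]
  refine Finset.sum_le_sum fun i _ => ?_
  rw [← mul_pow]
  gcongr
  exact T.le_opNorm _

lemma isCBFullK_mulLeftRight (A B : K →L[ℂ] K) : IsCBFullK (LinearMap.mulLeftRight ℂ (A, B)) := by
  refine ⟨‖B‖ * ‖star A‖, by positivity, fun k X hX v w => ?_⟩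
  have h := hX (fun i => B (v i)) (fun i => star A (w i))
  simp only [ContinuousLinearMap.star_eq_adjoint, ContinuousLinearMap.adjoint_inner_left] at h
  refine h.trans ?_
  calc _ ≤ 1 * (‖B‖ * Real.sqrt (∑ i, ‖v i‖ ^ 2)) *
        (‖star A‖ * Real.sqrt (∑ i, ‖w i‖ ^ 2)) := by
        gcongr
        · exact sqrt_sum_norm_apply_le B v
        · exact sqrt_sum_norm_apply_le (star A) w
    _ = _ := by ring

lemma isCBFullK_sum_smul {α : Type*} (s : Finset α) (c : α → ℂ)
    {φ : α → (K →L[ℂ] K) →ₗ[ℂ] (K →L[ℂ] K)} (h : ∀ a, IsCBFullK (φ a)) :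
    IsCBFullK (∑ a ∈ s, c a • φ a) := by
  choose d hd0 hd using h
  refine ⟨∑ a ∈ s, ‖c a‖ * d a, Finset.sum_nonneg fun a _ => mul_nonneg (norm_nonneg _) (hd0 a),
    fun k A hA v w => ?_⟩
  have : ∑ i, ∑ j, ⟪w i, (∑ a ∈ s, c a • φ a) (A i j) (v j)⟫ =
      ∑ a ∈ s, c a * ∑ i, ∑ j, ⟪w i, φ a (A i j) (v j)⟫ := by
    simp only [LinearMap.sum_apply, LinearMap.smul_apply, sum_apply, smul_apply, inner_sum,
      inner_smul_right, Finset.mul_sum]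
    rw [Finset.sum_comm]
    conv_rhs => rw [Finset.sum_comm]; enter [2, i]; rw [Finset.sum_comm]
    rw [Finset.sum_comm]
  rw [this, Finset.sum_mul, Finset.sum_mul]
  refine (norm_sum_le _ _).trans (Finset.sum_le_sum fun a _ => ?_)
  rw [norm_mul, mul_assoc, mul_assoc, ← mul_assoc (d a)]
  gcongr
  exact hd a k A hA v w

/-- The map `X ↦ ∑ a p q • b p * X * (b q)*`. -/
def elementary {α : Type*} [Fintype α] (a : α → α → ℂ) (b : α → K →L[ℂ] K) :
    (K →L[ℂ] K) →ₗ[ℂ] (K →L[ℂ] K) :=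
  ∑ p : α × α, a p.1 p.2 • LinearMap.mulLeftRight ℂ (b p.1, star (b p.2))

variable {α : Type*} [Fintype α] (a : α → α → ℂ)

lemma elementary_apply (b : α → K →L[ℂ] K) (X : K →L[ℂ] K) :
    elementary a b X = ∑ p, ∑ q, a p q • (b p * X * star (b q)) := by
  simp [elementary, LinearMap.sum_apply, Fintype.sum_prod_type]

lemma exists_isNormalPair_elementary {ι : Type*} (e : HilbertBasis ι ℂ K) (b : α → K →L[ℂ] K) :
    ∃ Φst, IsNormalPair e (elementary a b) Φst :=
  ⟨_, isNormalPair_sum_smul e _ _ fun _ => isNormalPair_mulLeftRight e _ _⟩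

lemma normalCB_elementary (b : α → K →L[ℂ] K) : NormalCB e (elementary a b) :=
  ⟨exists_isNormalPair_elementary a e b, isCBFullK_sum_smul _ _ fun _ => isCBFullK_mulLeftRight _ _⟩

lemma hsExt_elementary (m : HSModel e H) (b : α → K →L[ℂ] K) :
    HSExt m (elementary a b) (elementary a fun p => m.Lmul (b p)) := by
  have hsum : ∀ (s : Finset (α × α)) (c : α × α → K →L[ℂ] K),
      m.Lmul (∑ p ∈ s, c p) = ∑ p ∈ s, m.Lmul (c p) := fun s c =>
    map_sum (AddMonoidHom.mk' m.Lmul m.Lmul_add) c s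
  intro y x
  change elementary a _ (m.Rmul y * m.Lmul x) = m.Rmul y * m.Lmul (elementary a b x)
  rw [elementary_apply, elementary_apply, ← Fintype.sum_prod_type', ← Fintype.sum_prod_type', hsum,
    Finset.mul_sum]
  refine Finset.sum_congr rfl fun p _ => ?_
  rw [m.Lmul_smul, m.Lmul_mul, m.Lmul_mul, m.star_Lmul, mul_smul_comm, ← mul_assoc (m.Lmul _),
    m.Lmul_mul_Rmul]
  simp only [mul_assoc]

lemma elementary_rankOne (b : α → K →L[ℂ] K) (x : K) :
    elementary a b (rankOne x x) = ∑ p, ∑ q, a p q • rankOne (b p x) (b q x) := by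
  rw [elementary_apply]
  refine Finset.sum_congr rfl fun p _ => Finset.sum_congr rfl fun q _ => congrArg _ ?_
  ext z
  simp [rankOne_apply, ContinuousLinearMap.star_eq_adjoint,
    ContinuousLinearMap.adjoint_inner_right]

lemma pairing_elementary_rankOne {ι : Type*} (bK : HilbertBasis ι ℂ K) (b : α → K →L[ℂ] K)
    (x : K) {R : K →L[ℂ] K} (hR : IsTraceClass R) :
    pairing bK (elementary a b (rankOne x x)) R =
      ∑ p, ∑ q, a p q * ⟪b q x, R (b p x)⟫ := by
  rw [elementary_rankOne, pairing_sum_left bK _ _ hR]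
  refine Finset.sum_congr rfl fun p _ => ?_
  rw [pairing_sum_left bK _ _ hR]
  refine Finset.sum_congr rfl fun q _ => ?_
  rw [pairing_smul_left, pairing_rankOne_left]

end Elementary

section KPositivity

set_option linter.unusedSectionVars false

/-- A positive operator matrix gives a Gram matrix of a bounded operator, whence its form is a sum
of rank one forms. -/
lemma MatPos.exists_hasSum {k : ℕ} {X : Fin k → Fin k → K →L[ℂ] K} (hX : MatPos X) :
    ∃ (r : Set (PiLp 2 fun _ : Fin k => K)) (ξ : r → Fin k → K), ∀ v w : Fin k → K,
      HasSum (fun o => (∑ i, ⟪v i, ξ o i⟫) * ∑ i, ⟪ξ o i, w i⟫) (∑ i, ∑ j, ⟪v i, X i j (w j)⟫) := by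
  let T : (PiLp 2 fun _ : Fin k => K) →L[ℂ] (PiLp 2 fun _ : Fin k => K) :=
    (PiLp.continuousLinearEquiv 2 ℂ fun _ : Fin k => K).symm.toContinuousLinearMap ∘L
      (ContinuousLinearMap.pi fun i => ∑ j, X i j ∘L ContinuousLinearMap.proj j) ∘L
      (PiLp.continuousLinearEquiv 2 ℂ fun _ : Fin k => K).toContinuousLinearMap
  have hT : ∀ ζ ζ', ⟪ζ, T ζ'⟫ = ∑ i, ∑ j, ⟪ζ i, X i j (ζ' j)⟫ := fun ζ ζ' => by
    simp [T, PiLp.inner_apply, inner_sum, sum_apply]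
  have hpos : 0 ≤ T := by
    rw [ContinuousLinearMap.nonneg_iff_isPositive, ContinuousLinearMap.isPositive_iff_complex]
    intro ζ
    have h := hX fun i => ζ i
    rw [← hT, ← inner_conj_symm] at h
    obtain ⟨h1, h2⟩ := Complex.nonneg_iff.1 (star_nonneg_iff.1 h)
    exact ⟨Complex.ext rfl h2, h1⟩
  obtain ⟨B, hB⟩ := CStarAlgebra.nonneg_iff_eq_star_mul_self.1 hpos
  obtain ⟨r, o, ho⟩ := exists_hilbertBasis ℂ (PiLp 2 fun _ : Fin k => K)
  refine ⟨r, fun s i => adjoint B (o s) i, fun v w => ?_⟩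
  have h := o.hasSum_inner_mul_inner (B (WithLp.toLp 2 v)) (B (WithLp.toLp 2 w))
  have e1 : ⟪B (WithLp.toLp 2 v), B (WithLp.toLp 2 w)⟫ = ∑ i, ∑ j, ⟪v i, X i j (w j)⟫ := by
    rw [← ContinuousLinearMap.adjoint_inner_right, ← ContinuousLinearMap.star_eq_adjoint,
      ← mul_apply_eq_comp, ← hB, hT]
  rw [e1] at h
  refine h.congr_fun fun s => ?_
  rw [← ContinuousLinearMap.adjoint_inner_right B, ← ContinuousLinearMap.adjoint_inner_left B,
    PiLp.inner_apply, PiLp.inner_apply]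

lemma HSModel.sum_inner_mul_inner_nonneg (m : HSModel e H) {x0 : H}
    (hd : DenseRange (m.toOp x0)) {k : ℕ} {α : Type*} [Fintype α] {a : α → α → ℂ}
    {b : α → K →L[ℂ] K}
    (h : ∀ x, rankLE (m.toOp x) k →
      0 ≤ ∑ p, ∑ q, a p q * (⟪x, m.Lmul (b p) x0⟫ * ⟪m.Lmul (b q) x0, x⟫)) (v ξ : Fin k → K) :
    0 ≤ ∑ p, ∑ q, a p q * ((∑ i, ⟪v i, b p (ξ i)⟫) * ∑ i, ⟪b q (ξ i), v i⟫) := by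
  have hcl : IsClosed {ξ : Fin k → K |
      0 ≤ ∑ p, ∑ q, a p q * ((∑ i, ⟪v i, b p (ξ i)⟫) * ∑ i, ⟪b q (ξ i), v i⟫)} :=
    isClosed_le continuous_const (by fun_prop)
  have hpi : DenseRange (Pi.map fun _ : Fin k => m.toOp x0) := DenseRange.piMap fun _ => hd
  refine hcl.closure_subset_iff.2 ?_ (hpi ξ)
  rintro _ ⟨η, rfl⟩
  have hrank : rankLE (m.toOp (∑ i, m.elem (v i) (η i))) k := by
    refine rankLE_iff.2 ⟨v, fun z => ?_⟩
    rw [map_sum, sum_apply]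
    refine Submodule.sum_mem _ fun i _ => ?_
    rw [m.toOp_elem, rankOne_apply]
    exact Submodule.smul_mem _ _ (Submodule.subset_span ⟨i, rfl⟩)
  refine (h _ hrank).trans_eq ?_
  simp only [sum_inner, inner_sum, m.inner_elem_left, m.inner_elem_right, m.Lmul_eq, Pi.map_apply,
    ContinuousLinearMap.comp_apply]

lemma kPos_elementary (m : HSModel e H) {x0 : H}
    (hd : DenseRange (m.toOp x0)) {k : ℕ} {α : Type*} [Fintype α] {a : α → α → ℂ}
    {b : α → K →L[ℂ] K}
    (h : ∀ x, rankLE (m.toOp x) k →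
      0 ≤ ∑ p, ∑ q, a p q * (⟪x, m.Lmul (b p) x0⟫ * ⟪m.Lmul (b q) x0, x⟫)) :
    kPos k (elementary a b) := by
  intro X hX v
  obtain ⟨r, ξ, hξ⟩ := hX.exists_hasSum
  have hs := hasSum_sum (s := Finset.univ) fun (p : α × α) _ =>
    (hξ (fun i => star (b p.1) (v i)) (fun i => star (b p.2) (v i))).mul_left (a p.1 p.2)
  refine (hs.nonneg fun o => ?_).trans_eq ?_
  · rw [Fintype.sum_prod_type]
    refine (m.sum_inner_mul_inner_nonneg hd h v (ξ o)).trans_eq ?_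
    simp only [ContinuousLinearMap.star_eq_adjoint, ContinuousLinearMap.adjoint_inner_left,
      ContinuousLinearMap.adjoint_inner_right]
  · simp only [elementary_apply, ContinuousLinearMap.star_eq_adjoint,
      ContinuousLinearMap.adjoint_inner_left, sum_apply, smul_apply, inner_sum, inner_smul_right,
      Finset.mul_sum, Fintype.sum_prod_type, mul_apply_eq_comp]
    rw [sum_sum_comm_sum_sum]

end KPositivity

section Separation

set_option linter.unusedSectionVars false

variable {α : Type*} [Fintype α]

lemma exists_coeff_of_dual (f : StrongDual ℝ (α × α → ℂ)) :
    ∃ a : α → α → ℂ, ∀ M : α × α → ℂ, (∀ p q, M (q, p) = starRingEnd ℂ (M (p, q))) →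
      ∑ p, ∑ q, a p q * M (q, p) = ((2 * f M : ℝ) : ℂ) := by
  classical
  let F : StrongDual ℂ (α × α → ℂ) := f.extendRCLike
  let c : α × α → ℂ := fun s => F fun t => if s = t then 1 else 0
  have hF : ∀ M, F M = ∑ p, ∑ q, M (p, q) * c (p, q) := fun M => by
    rw [← Fintype.sum_prod_type']
    exact LinearMap.pi_apply_eq_sum_univ F.toLinearMap M
  refine ⟨fun p q => c (q, p) + starRingEnd ℂ (c (p, q)), fun M hM => ?_⟩
  have h1 : ∑ p, ∑ q, (c (q, p) + starRingEnd ℂ (c (p, q))) * M (q, p) =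
      F M + starRingEnd ℂ (F M) := by
    simp only [add_mul, Finset.sum_add_distrib]
    congr 1
    · rw [hF, Finset.sum_comm]
      simp only [mul_comm]
    · simp only [hF, map_sum, map_mul, ← hM, mul_comm]
  have h2 : (F M).re = f M := StrongDual.re_extendRCLike_apply (𝕜 := ℂ) f M
  rw [h1, Complex.add_conj, h2]

/-- A finite matrix on which every coefficient form positive on the rank one matrices of vectors
of `S` is nonnegative is a limit of sums of such rank one matrices. -/
lemma exists_gram_approx {S : Set H} (hS : ∀ x ∈ S, ∀ c : ℂ, c • x ∈ S) (U : α → H)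
    {r : α → α → ℂ} (hr : ∀ p q, r q p = starRingEnd ℂ (r p q))
    (h : ∀ a : α → α → ℂ, (∀ x ∈ S, 0 ≤ ∑ p, ∑ q, a p q * (⟪x, U p⟫ * ⟪U q, x⟫)) →
      0 ≤ ∑ p, ∑ q, a p q * r q p) {ε : ℝ} (hε : 0 < ε) :
    ∃ (n : ℕ) (x : Fin n → H), (∀ i, x i ∈ S) ∧
      ∀ p q, ‖r p q - ∑ i, ⟪U p, x i⟫ * ⟪x i, U q⟫‖ < ε := by
  let gram : H → α × α → ℂ := fun x s => ⟪U s.1, x⟫ * ⟪x, U s.2⟫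
  have hgram : ∀ x p q, gram x (q, p) = starRingEnd ℂ (gram x (p, q)) := fun x p q => by
    simp [gram, mul_comm]
  let C : Submodule NNReal (α × α → ℂ) := Submodule.span NNReal (gram '' S)
  have hC : ∀ M ∈ C, ∃ (n : ℕ) (x : Fin n → H), (∀ i, x i ∈ S) ∧ M = ∑ i, gram (x i) := by
    intro M hM
    induction hM using Submodule.span_induction with
    | mem M hM =>
      obtain ⟨x, hx, rfl⟩ := hM
      exact ⟨1, fun _ => x, fun _ => hx, by simp⟩
    | zero => exact ⟨0, Fin.elim0, fun i => i.elim0, by simp⟩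
    | add M N _ _ hM hN =>
      obtain ⟨n, x, hx, rfl⟩ := hM
      obtain ⟨n', x', hx', rfl⟩ := hN
      refine ⟨n + n', Fin.append x x', fun i => ?_, by simp [Fin.sum_univ_add]⟩
      refine Fin.addCases (fun i => ?_) (fun i => ?_) i
      · simpa using hx i
      · simpa using hx' i
    | smul t M _ hM =>
      obtain ⟨n, x, hx, rfl⟩ := hM
      refine ⟨n, fun i => ((Real.sqrt t : ℝ) : ℂ) • x i, fun i => hS _ (hx i) _, ?_⟩
      rw [Finset.smul_sum]
      refine Finset.sum_congr rfl fun i _ => funext fun s => ?_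
      have ht : ((Real.sqrt t : ℝ) : ℂ) * ((Real.sqrt t : ℝ) : ℂ) = ((t : ℝ) : ℂ) := by
        rw [← Complex.ofReal_mul, Real.mul_self_sqrt t.coe_nonneg]
      simp only [gram, Pi.smul_apply, inner_smul_right, inner_smul_left, Complex.conj_ofReal,
        NNReal.smul_def, Complex.real_smul, ← ht]
      ring
  have hmem : (fun s => r s.1 s.2) ∈ C.closure := by
    by_contra hn
    obtain ⟨f, hf, hfr⟩ := ProperCone.hyperplane_separation_point C.closure hn
    obtain ⟨a, ha⟩ := exists_coeff_of_dual f
    have h1 := h a fun x hx => by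
      have h2 := ha (gram x) (hgram x)
      have h3 : 0 ≤ f (gram x) := hf _ (Submodule.mem_closure_iff.2
        (Submodule.le_topologicalClosure _ (Submodule.subset_span ⟨x, hx, rfl⟩)))
      have h4 : (0 : ℂ) ≤ ((2 * f (gram x) : ℝ) : ℂ) := Complex.zero_le_real.2 (by positivity)
      rw [← h2] at h4
      refine h4.trans_eq ?_
      simp only [gram, mul_comm ⟪x, _⟫]
    rw [ha (fun s => r s.1 s.2) hr, Complex.zero_le_real] at h1
    linarith
  rw [Submodule.mem_closure_iff] at hmem
  obtain ⟨M, hM, hlt⟩ := Metric.mem_closure_iff.1 hmem ε hε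
  obtain ⟨n, x, hx, rfl⟩ := hC M hM
  refine ⟨n, x, hx, fun p q => ?_⟩
  have h1 := (dist_le_pi_dist _ _ (p, q)).trans_lt hlt
  rw [dist_eq_norm] at h1
  simpa [gram] using h1

end Separation

section Sufficiency

set_option linter.unusedSectionVars false

lemma rankLE.mul_mul {T : K →L[ℂ] K} {k : ℕ} (hT : rankLE T k) (A B : K →L[ℂ] K) :
    rankLE (A * T * B) k := by
  obtain ⟨f, hf⟩ := rankLE_iff.1 hT
  refine rankLE_iff.2 ⟨fun i => A (f i), fun v => ?_⟩
  have h := Submodule.mem_map_of_mem (f := (A : K →ₗ[ℂ] K)) (hf (B v))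
  rw [Submodule.map_span, ← Set.range_comp] at h
  exact h

lemma rankLE.smul {T : K →L[ℂ] K} {k : ℕ} (hT : rankLE T k) (c : ℂ) : rankLE (c • T) k := by
  simpa using hT.mul_mul (c • 1) 1

lemma HSModel.rankLE_compress (m : HSModel e H) {α β : Type*} [Fintype α] [Fintype β] (f : α → K)
    (g : β → K) {x : H} {k : ℕ} (hx : rankLE (m.toOp x) k) :
    rankLE (m.toOp (∑ p, ⟪m.tensor f g p, x⟫ • m.tensor f g p)) k := by
  have h : m.toOp (∑ p, ⟪m.tensor f g p, x⟫ • m.tensor f g p) =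
      (∑ i, rankOne (f i) (f i)) * m.toOp x * ∑ j, rankOne (g j) (g j) := by
    ext v
    simp only [HSModel.tensor, map_sum, map_smul, m.toOp_elem, m.inner_elem_left, sum_apply,
      smul_apply, rankOne_apply, mul_apply_eq_comp, Fintype.sum_prod_type, Finset.smul_sum,
      smul_smul, mul_comm]
    rw [Finset.sum_comm]
  rw [h]
  exact hx.mul_mul _ _

lemma rankOne_compress {α : Type*} [Fintype α] (U : α → H) (x : H) :
    rankOne (∑ p, ⟪U p, x⟫ • U p) (∑ p, ⟪U p, x⟫ • U p) =
      ∑ p, ∑ q, (⟪U p, x⟫ * ⟪x, U q⟫) • rankOne (U p) (U q) := by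
  simp only [rankOne_sum_sum, rankOne_smul_smul, inner_conj_symm]

lemma mem_schmidtCone_of_forall_elementary (m : HSModel e H) {x0 : H} {k : ℕ} {R : H →L[ℂ] H}
    (hcyc : DenseRange (adjoint (m.toOp x0))) (hR : IsTraceClass R) (hRsa : IsSelfAdjoint R)
    (h : ∀ {a b : ℕ} (c : Fin a × Fin b → Fin a × Fin b → ℂ) (t : Fin a × Fin b → K →L[ℂ] K),
      (∀ x, rankLE (m.toOp x) k →
        0 ≤ ∑ p, ∑ q, c p q * (⟪x, m.Lmul (t p) x0⟫ * ⟪m.Lmul (t q) x0, x⟫)) →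
      0 ≤ ∑ p, ∑ q, c p q * ⟪m.Lmul (t q) x0, R (m.Lmul (t p) x0)⟫) :
    R ∈ SchmidtCone m k := by
  intro ε hε
  obtain ⟨a, b, f, g, hf, hg, hgV, hB⟩ := exists_truncation m
    (V := LinearMap.range (adjoint (m.toOp x0) : K →ₗ[ℂ] K)) hcyc hR (half_pos hε)
  choose y hy using hgV
  set U := m.tensor f g with hU
  have hUt : ∀ p, m.Lmul (rankOne (f p.1) (y p.2)) x0 = U p := fun p => by
    rw [m.Lmul_rankOne_apply]
    exact congrArg _ (hy p.2)
  set N : ℝ := ∑ _p : Fin a × Fin b, ∑ _q : Fin a × Fin b, 1 with hN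
  have hN0 : 0 ≤ N := Finset.sum_nonneg fun _ _ => Finset.sum_nonneg fun _ _ => zero_le_one
  obtain ⟨n, x, hx, hlt⟩ := exists_gram_approx (S := {x | rankLE (m.toOp x) k})
    (fun x hx c => by
      rw [Set.mem_ofPred_eq, map_smul]
      exact rankLE.smul hx c) U (r := fun p q => ⟪U p, R (U q)⟫)
    (fun p q => by
      rw [inner_conj_symm, ← ContinuousLinearMap.adjoint_inner_left, hRsa.adjoint_eq])
    (fun c hc => by
      have := h c (fun p => rankOne (f p.1) (y p.2)) fun x hx => by
        simpa only [hUt] using hc x hx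
      simpa only [hUt] using this)
    (ε := ε / (2 * (N + 1))) (by positivity)
  refine ⟨n, fun i => ∑ p, ⟪U p, x i⟫ • U p, fun i => m.rankLE_compress f g (hx i), ?_⟩
  have hD : NucBound (∑ p, ∑ q, (⟪U p, R (U q)⟫ - ∑ i, ⟪U p, x i⟫ * ⟪x i, U q⟫) •
      rankOne (U p) (U q)) (∑ _p : Fin a × Fin b, ∑ _q : Fin a × Fin b, ε / (2 * (N + 1))) := by
    refine nucBound_sum _ _ _ fun p _ => nucBound_sum _ _ _ fun q _ => ?_
    have hn : ∀ p, ‖U p‖ = 1 := (m.orthonormal_tensor hf hg).1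
    refine ((nucBound_rankOne (U p) (U q)).smul _).mono ?_
    rw [hn, hn, mul_one, mul_one]
    exact (hlt p q).le
  have hsum := (hB.add hD).traceNorm_le
  have heq : R - ∑ i, rankOne (∑ p, ⟪U p, x i⟫ • U p) (∑ p, ⟪U p, x i⟫ • U p) =
      R - ∑ p, ∑ q, ⟪U p, R (U q)⟫ • rankOne (U p) (U q) +
      ∑ p, ∑ q, (⟪U p, R (U q)⟫ - ∑ i, ⟪U p, x i⟫ * ⟪x i, U q⟫) • rankOne (U p) (U q) := by
    simp only [rankOne_compress, sub_smul, Finset.sum_sub_distrib, Finset.sum_smul]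
    rw [Finset.sum_comm]
    conv_lhs => enter [2, 2, p]; rw [Finset.sum_comm]
    abel
  rw [heq]
  refine hsum.trans_lt ?_
  have h2 : ∑ _p : Fin a × Fin b, ∑ _q : Fin a × Fin b, ε / (2 * (N + 1)) =
      N * (ε / (2 * (N + 1))) := by
    rw [hN, Finset.sum_mul]
    simp only [Finset.sum_mul, one_mul]
  have h3 : N * (ε / (2 * (N + 1))) < (N + 1) * (ε / (2 * (N + 1))) := by
    gcongr
    linarith
  have h4 : (N + 1) * (ε / (2 * (N + 1))) = ε / 2 := by field_simp
  linarith

end Sufficiency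

/-- Theorem 5.3.  For a normal positive functional `ρ` on
`B(H)` — implemented by a positive trace class operator `R` — the following
are equivalent: (i) `ρ` has Schmidt number not bigger than `k`, i.e.
`ρ ∈ 𝒮_k`; (ii) `⟨C_φ, ρ⟩ ≥ 0` for every `k`-positive map `φ ∈ P^σ_k`. -/
theorem statement13
    {K : Type*} [NormedAddCommGroup K] [InnerProductSpace ℂ K] [CompleteSpace K]
    [TopologicalSpace.SeparableSpace K]
    {ι : Type*} (e : HilbertBasis ι ℂ K)
    {H : Type*} [NormedAddCommGroup H] [InnerProductSpace ℂ H] [CompleteSpace H]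
    {ιH : Type*} (bH : HilbertBasis ιH ℂ H)
    (m : HSModel e H) (x0 : H) (hx0 : ‖x0‖ = 1)
    (hcyc : Dense {y : H | ∃ a : K →L[ℂ] K, m.Lmul a x0 = y})
    (hsep : ∀ a : K →L[ℂ] K, m.Lmul a x0 = 0 → m.Lmul a = 0)
    (k : ℕ) (R : H →L[ℂ] H) (hRtc : IsTraceClass R) (hRpos : R.IsPositive) :
    R ∈ SchmidtCone m k ↔
      ∀ (φ : (K →L[ℂ] K) →ₗ[ℂ] (K →L[ℂ] K)) (Φ Φst : (H →L[ℂ] H) →ₗ[ℂ] (H →L[ℂ] H)),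
        kPos k φ → NormalCB e φ → HSExt m φ Φ → IsNormalPair bH Φ Φst →
        0 ≤ pairing bH (Φ (rankOne x0 x0)) R := by
  have hcyc' := m.denseRange_adjoint_of_cyclic hcyc
  have hsep' := m.denseRange_toOp_of_separating hsep
  constructor
  · intro hRS φ Φ Φst hφ _ hΦ hn
    exact pairing_nonneg_of_mem_schmidtCone bH hRtc hRS fun x hx => inner_choi_nonneg hφ hΦ hn hx x0
  · intro h
    refine mem_schmidtCone_of_forall_elementary m hcyc' hRtc hRpos.isSelfAdjoint fun c t hc => ?_
    obtain ⟨Φst, hΦst⟩ := exists_isNormalPair_elementary c bH fun p => m.Lmul (t p)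
    rw [← pairing_elementary_rankOne c bH _ x0 hRtc]
    exact h _ _ Φst (kPos_elementary m hsep' hc) (normalCB_elementary c t)
      (hsExt_elementary c m t) hΦst

end ChoiInf
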